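/- arXiv:2602.05667 — 2 statements merged into one kernel-verified Lean document; each statement's English description precedes it below -/
import Mathlib

section
/- Let (Ω, ℱ, P) be a probability space with a filtration ℱ_0 ⊆ ℱ_1 ⊆ ⋯ ⊆ ℱ_m, let w ∈ [0,1], and let A_1, …, A_m be events with A_t ∈ ℱ_t for each t. Suppose that for every t ∈ {1,…,m}, the conditional probability satisfies E[1_{A_t} | ℱ_{t−1}] ≥ w almost everywhere on the event ⋂_{s<t} A_sᶜ. Then P(⋂_{t=1}^m A_tᶜ) ≤ (1 − w)^m. -/
open MeasureTheory

/-- **Sequential miss probability bound.**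
Let `(Ω, ℱ, P)` be a probability space with a filtration `ℱ_0 ⊆ ⋯ ⊆ ℱ_m`,
`w ∈ [0,1]`, and events `A_1, …, A_m` with `A_t ∈ ℱ_t`.  If for every
`t ∈ {1,…,m}` the conditional probability `E[1_{A_t} | ℱ_{t−1}] ≥ w` holds
almost everywhere on `⋂_{s<t} A_sᶜ`, then
`P(⋂_{t=1}^m A_tᶜ) ≤ (1 − w)^m`. -/
theorem sequential_miss_prob_bound
    {Ω : Type*} {m0 : MeasurableSpace Ω} (μ : Measure Ω) [IsProbabilityMeasure μ]
    (m : ℕ) (ℱ : Filtration ℕ m0)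
    (w : ℝ) (hw0 : 0 ≤ w) (hw1 : w ≤ 1)
    (A : ℕ → Set Ω)
    (hA : ∀ t ∈ Finset.Icc 1 m, MeasurableSet[ℱ t] (A t))
    (hcond : ∀ t ∈ Finset.Icc 1 m,
      ∀ᵐ ω ∂μ, ω ∈ ⋂ s ∈ Finset.Ico 1 t, (A s)ᶜ →
        w ≤ (μ[(A t).indicator (fun _ => (1 : ℝ)) | ℱ (t - 1)]) ω) :
    μ (⋂ t ∈ Finset.Icc 1 m, (A t)ᶜ) ≤ ENNReal.ofReal ((1 - w) ^ m) := by
  have key : ∀ k, k ≤ m → μ.real (⋂ t ∈ Finset.Icc 1 k, (A t)ᶜ) ≤ (1 - w) ^ k := by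
    intro k
    induction k with
    | zero => intro _; simp
    | succ k ih =>
      intro hk
      have ihk := ih (by omega)
      have hmem : k + 1 ∈ Finset.Icc 1 m := Finset.mem_Icc.2 ⟨by omega, hk⟩
      have hAk : MeasurableSet (A (k + 1)) := ℱ.le _ _ (hA _ hmem)
      have hc := hcond _ hmem
      have hIco : Finset.Ico 1 (k + 1) = Finset.Icc 1 k := by
        ext x; simp only [Finset.mem_Ico, Finset.mem_Icc]; omega
      rw [hIco, Nat.add_sub_cancel] at hc
      have hset : (⋂ t ∈ Finset.Icc 1 (k + 1), (A t)ᶜ)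
          = (⋂ t ∈ Finset.Icc 1 k, (A t)ᶜ) \ A (k + 1) := by
        ext x
        simp only [Set.mem_iInter, Finset.mem_Icc, Set.mem_compl_iff, Set.mem_sdiff]
        constructor
        · intro h
          exact ⟨fun i hi => h i ⟨hi.1, by omega⟩, h _ ⟨by omega, le_rfl⟩⟩
        · rintro ⟨h1, h2⟩ i hi
          rcases Nat.lt_or_ge k i with h | h
          · have : i = k + 1 := by omega
            rwa [this]
          · exact h1 i ⟨hi.1, h⟩
      have hB : MeasurableSet[ℱ k] (⋂ t ∈ Finset.Icc 1 k, (A t)ᶜ) := by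
        refine Finset.measurableSet_biInter _ fun t ht => ?_
        have ht' := Finset.mem_Icc.1 ht
        exact (ℱ.mono ht'.2 _ (hA t (Finset.mem_Icc.2 ⟨ht'.1, by omega⟩))).compl
      rw [hset]
      generalize (⋂ t ∈ Finset.Icc 1 k, (A t)ᶜ) = B at *
      have hB0 : MeasurableSet B := ℱ.le _ _ hB
      have hint : Integrable ((A (k + 1)).indicator (fun _ => (1 : ℝ))) μ :=
        (integrable_const _).indicator hAk
      have h1 := setIntegral_condExp (ℱ.le k) hint hB
      have h2 : ∫ x in B, (A (k + 1)).indicator (fun _ => (1 : ℝ)) x ∂μ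
          = μ.real (B ∩ A (k + 1)) := by
        rw [setIntegral_indicator hAk]; simp
      have h3 : ∫ _ in B, w ∂μ
          ≤ ∫ x in B, (μ[(A (k + 1)).indicator (fun _ => (1 : ℝ)) | ℱ k]) x ∂μ :=
        setIntegral_mono_on_ae (integrable_const _).integrableOn
          integrable_condExp.integrableOn hB0 hc
      have h4 : ∫ _ in B, w ∂μ = μ.real B * w := by simp
      have h5 := measureReal_inter_add_sdiff (μ := μ) (s := B) hAk
      have h6 : μ.real B * (1 - w) ≤ (1 - w) ^ k * (1 - w) :=
        mul_le_mul_of_nonneg_right ihk (by linarith)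
      rw [pow_succ]
      linarith
  rw [← ofReal_measureReal]
  exact ENNReal.ofReal_le_ofReal (key m le_rfl)
end

section
/- Let (Ω, ℱ, P) be a probability space with a filtration ℱ_0 ⊆ ℱ_1 ⊆ ⋯ ⊆ ℱ_m, let w ∈ (0, 1], let δ ∈ (0, 1), and let N ≥ 1 be a natural number. For each j ∈ {1,…,N}, let A_{j,1}, …, A_{j,m} be events with A_{j,t} ∈ ℱ_t, such that for every t, E[1_{A_{j,t}} | ℱ_{t−1}] ≥ w almost everywhere on ⋂_{s<t} A_{j,s}ᶜ. If m ≥ (1/w) · (log N + log(1/δ)), then P(∃ j ∈ {1,…,N} : ⋂_{t=1}^m A_{j,t}ᶜ) ≤ N · (1 − w)^m ≤ δ; equivalently, with probability at least 1 − δ, every index j has at least one t with A_{j,t} occurring. -/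
open MeasureTheory

lemma single_ball_bound
    {Ω : Type*} {m0 : MeasurableSpace Ω} (μ : Measure Ω) [IsProbabilityMeasure μ]
    (m : ℕ) (ℱ : Filtration ℕ m0) (w : ℝ) (hw1 : w ≤ 1)
    (B : ℕ → Set Ω)
    (hB : ∀ t ∈ Finset.Icc 1 m, MeasurableSet[ℱ t] (B t))
    (hcond : ∀ t ∈ Finset.Icc 1 m,
      ∀ᵐ ω ∂μ, ω ∈ ⋂ s ∈ Finset.Ico 1 t, (B s)ᶜ →
        w ≤ (μ[(B t).indicator (fun _ => (1 : ℝ)) | ℱ (t - 1)]) ω)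
    (k : ℕ) (hk : k ≤ m) :
    μ.real (⋂ t ∈ Finset.Ico 1 (k + 1), (B t)ᶜ) ≤ (1 - w) ^ k := by
  induction k with
  | zero => simp
  | succ k ih =>
    have ih := ih (by omega)
    have hmem : k + 1 ∈ Finset.Icc 1 m := by simp; omega
    have hS : MeasurableSet[ℱ k] (⋂ t ∈ Finset.Ico 1 (k + 1), (B t)ᶜ) := by
      refine Finset.measurableSet_biInter _ fun t ht => ?_
      rw [Finset.mem_Ico] at ht
      exact (ℱ.mono (by omega : t ≤ k) _ (hB t (by simp; omega))).compl
    have hBm : MeasurableSet (B (k + 1)) := ℱ.le _ _ (hB _ hmem)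
    have hc := hcond _ hmem
    rw [Nat.add_sub_cancel] at hc
    have hset : (⋂ t ∈ Finset.Ico 1 (k + 1 + 1), (B t)ᶜ)
        = (⋂ t ∈ Finset.Ico 1 (k + 1), (B t)ᶜ) \ B (k + 1) := by
      ext ω
      simp only [Set.mem_iInter, Finset.mem_Ico, Set.mem_compl_iff, Set.mem_sdiff]
      constructor
      · exact fun h => ⟨fun t ht => h t (by omega), h _ (by omega)⟩
      · rintro ⟨h1, h2⟩ t ht
        rcases Nat.lt_or_ge t (k + 1) with h | h
        · exact h1 t (by omega)
        · obtain rfl : t = k + 1 := by omega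
          exact h2
    rw [hset]
    generalize (⋂ t ∈ Finset.Ico 1 (k + 1), (B t)ᶜ) = S at *
    have hSm : MeasurableSet S := ℱ.le _ _ hS
    have hint : Integrable ((B (k + 1)).indicator (fun _ => (1 : ℝ))) μ :=
      (integrable_const 1).indicator hBm
    have h1 := setIntegral_condExp (ℱ.le k) hint hS
    have h2 : ∫ ω in S, (B (k + 1)).indicator (fun _ => (1 : ℝ)) ω ∂μ
        = μ.real (S ∩ B (k + 1)) := by
      rw [setIntegral_indicator hBm]
      simp
    have h3 : ∫ _ in S, w ∂μ
        ≤ ∫ ω in S, (μ[(B (k + 1)).indicator (fun _ => (1 : ℝ)) | ℱ k]) ω ∂μ :=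
      setIntegral_mono_on_ae (integrable_const w).integrableOn
        integrable_condExp.integrableOn hSm hc
    rw [h1, h2, setIntegral_const, smul_eq_mul] at h3
    have h4 := measureReal_inter_add_sdiff (μ := μ) (s := S) hBm
    rw [pow_succ]
    nlinarith [mul_le_mul_of_nonneg_right ih (by linarith : 0 ≤ 1 - w)]

/-- **ε-coverage via a union bound over covering balls.**
Let `(Ω, ℱ, P)` be a probability space with a filtration, `w ∈ (0,1]`,
`δ ∈ (0,1)`, and `N ≥ 1` covering balls.  For each `j ∈ {1,…,N}` let
`A_{j,1}, …, A_{j,m}` be events with `A_{j,t} ∈ ℱ_t` such that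
`E[1_{A_{j,t}} | ℱ_{t−1}] ≥ w` a.e. on `⋂_{s<t} A_{j,s}ᶜ`.  If
`m ≥ (1/w)(log N + log(1/δ))`, then
`P(∃ j, ⋂_t A_{j,t}ᶜ) ≤ N (1 − w)^m ≤ δ`. -/
theorem eps_cover_union_bound
    {Ω : Type*} {m0 : MeasurableSpace Ω} (μ : Measure Ω) [IsProbabilityMeasure μ]
    (m N : ℕ) (hN : 1 ≤ N) (ℱ : Filtration ℕ m0)
    (w δ : ℝ) (hw0 : 0 < w) (hw1 : w ≤ 1) (hδ0 : 0 < δ) (hδ1 : δ < 1)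
    (A : ℕ → ℕ → Set Ω)
    (hA : ∀ j ∈ Finset.Icc 1 N, ∀ t ∈ Finset.Icc 1 m, MeasurableSet[ℱ t] (A j t))
    (hcond : ∀ j ∈ Finset.Icc 1 N, ∀ t ∈ Finset.Icc 1 m,
      ∀ᵐ ω ∂μ, ω ∈ ⋂ s ∈ Finset.Ico 1 t, (A j s)ᶜ →
        w ≤ (μ[(A j t).indicator (fun _ => (1 : ℝ)) | ℱ (t - 1)]) ω)
    (hm : (1 / w) * (Real.log N + Real.log (1 / δ)) ≤ (m : ℝ)) :
    μ (⋃ j ∈ Finset.Icc 1 N, ⋂ t ∈ Finset.Icc 1 m, (A j t)ᶜ)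
        ≤ ENNReal.ofReal ((N : ℝ) * (1 - w) ^ m)
    ∧ ENNReal.ofReal ((N : ℝ) * (1 - w) ^ m) ≤ ENNReal.ofReal δ := by
  have hNpos : (0 : ℝ) < N := by exact_mod_cast hN
  constructor
  · refine (measure_biUnion_finset_le _ _).trans ?_
    have hj : ∀ j ∈ Finset.Icc 1 N, μ (⋂ t ∈ Finset.Icc 1 m, (A j t)ᶜ)
        ≤ ENNReal.ofReal ((1 - w) ^ m) := by
      intro j hj
      have h := single_ball_bound μ m ℱ w hw1 (A j) (hA j hj) (hcond j hj) m le_rfl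
      have hI : Finset.Ico 1 (m + 1) = Finset.Icc 1 m := by
        ext; simp only [Finset.mem_Ico, Finset.mem_Icc]; omega
      rw [hI] at h
      rw [← ofReal_measureReal]
      exact ENNReal.ofReal_le_ofReal h
    refine (Finset.sum_le_sum hj).trans ?_
    rw [ENNReal.ofReal_mul hNpos.le]
    simp
  · apply ENNReal.ofReal_le_ofReal
    have h1 : (1 - w) ^ m ≤ Real.exp (-(w * m)) := by
      have h := pow_le_pow_left₀ (by linarith) (Real.one_sub_le_exp_neg w) m
      rw [← Real.exp_nat_mul] at h
      rwa [mul_neg, mul_comm (m : ℝ) w] at h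
    have h2 : Real.log N - Real.log δ ≤ w * m := by
      have h := mul_le_mul_of_nonneg_left hm hw0.le
      rw [one_div δ, Real.log_inv, ← mul_assoc, mul_one_div_cancel hw0.ne'] at h
      linarith
    calc (N : ℝ) * (1 - w) ^ m ≤ N * Real.exp (-(w * m)) := by gcongr
      _ = Real.exp (Real.log N + -(w * m)) := by rw [Real.exp_add, Real.exp_log hNpos]
      _ ≤ Real.exp (Real.log δ) := Real.exp_le_exp.mpr (by linarith)
      _ = δ := Real.exp_log hδ0
end
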